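/- Classification of elements, μ = 4 case (Theorem 3.5 via the Thurston representation). Let G ≤ SL(2,ℝ) be the subgroup generated by A(2) and B(2) (i.e., s = 2, μ = 4). Then for every g ∈ G: |tr g| > 2 (i.e., g is hyperbolic, corresponding to a pseudo-Anosov mapping class) if and only if there do NOT exist h ∈ G and k ∈ ℤ with h·g·h⁻¹ equal to A(2)^k, B(2)^k, or (A(2)·B(2))^k. -/

import Mathlib

open Matrix

noncomputable section

abbrev SL2R := Matrix.SpecialLinearGroup (Fin 2) ℝ

/-- The matrix `A(2) = [[1, -2], [0, 1]]` of Thurston's construction with `μ = 4`. -/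
def Amat2 : SL2R := ⟨!![1, -2; 0, 1], by simp [Matrix.det_fin_two_of]⟩

/-- The matrix `B(2) = [[1, 0], [2, 1]]` of Thurston's construction with `μ = 4`. -/
def Bmat2 : SL2R := ⟨!![1, 0; 2, 1], by simp [Matrix.det_fin_two_of]⟩

theorem zpow_eq_of_rec {G : Type*} [Group G] (a : G) (F : ℤ → G) (h0 : F 0 = 1)
    (h1 : ∀ k, F (k + 1) = F k * a) (k : ℤ) : a ^ k = F k := by
  induction k using Int.induction_on with
  | zero => simp [h0]
  | succ n ih => rw [_root_.zpow_add_one, ih, h1]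
  | pred n ih =>
    rw [_root_.zpow_sub_one, ih]
    have := h1 (-(n : ℤ) - 1)
    rw [sub_add_cancel] at this
    rw [this, mul_inv_cancel_right]

def upM (t : ℝ) : SL2R := ⟨!![1, t; 0, 1], by simp [Matrix.det_fin_two_of]⟩

def loM (t : ℝ) : SL2R := ⟨!![1, 0; t, 1], by simp [Matrix.det_fin_two_of]⟩

def cuM (t : ℝ) : SL2R := ⟨!![1 + t, t; -t, 1 - t], by
  rw [Matrix.det_fin_two_of]; ring⟩

theorem Amat2_zpow (k : ℤ) : Amat2 ^ k = upM (-2 * k) := by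
  apply zpow_eq_of_rec Amat2 (fun k : ℤ => upM (-2 * k))
  · ext i j; fin_cases i <;> fin_cases j <;> simp [upM]
  · intro k
    apply Subtype.ext
    change _ = (upM (-2 * k)).1 * Amat2.1
    ext i j
    fin_cases i <;> fin_cases j <;>
      simp [upM, Amat2, Matrix.mul_apply, Fin.sum_univ_two] <;> ring

theorem Bmat2_zpow (k : ℤ) : Bmat2 ^ k = loM (2 * k) := by
  apply zpow_eq_of_rec Bmat2 (fun k : ℤ => loM (2 * k))
  · ext i j; fin_cases i <;> fin_cases j <;> simp [loM]
  · intro k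
    apply Subtype.ext
    change _ = (loM (2 * k)).1 * Bmat2.1
    ext i j
    fin_cases i <;> fin_cases j <;>
      simp [loM, Bmat2, Matrix.mul_apply, Fin.sum_univ_two] <;> ring

theorem AB_val : (Amat2 * Bmat2).1 = !![-3, -2; 2, 1] := by
  change Amat2.1 * Bmat2.1 = _
  ext i j
  fin_cases i <;> fin_cases j <;>
    simp [Amat2, Bmat2, Matrix.mul_apply, Fin.sum_univ_two] <;> norm_num

theorem AB_zpow_even (k : ℤ) : (Amat2 * Bmat2) ^ (2 * k) = cuM (4 * k) := by
  rw [_root_.zpow_mul]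
  apply zpow_eq_of_rec _ (fun k : ℤ => cuM (4 * k))
  · ext i j; fin_cases i <;> fin_cases j <;> simp [cuM]
  · intro k
    apply Subtype.ext
    have : ((Amat2 * Bmat2) ^ (2 : ℤ)).1 = !![5, 4; -4, -3] := by
      have h2 : (Amat2 * Bmat2) ^ (2 : ℤ) = (Amat2 * Bmat2) * (Amat2 * Bmat2) := by
        rw [zpow_two]
      rw [h2]
      change (Amat2 * Bmat2).1 * (Amat2 * Bmat2).1 = _
      rw [AB_val]
      ext i j
      fin_cases i <;> fin_cases j <;>
        simp [Matrix.mul_apply, Fin.sum_univ_two] <;> norm_num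
    change _ = (cuM (4 * k)).1 * ((Amat2 * Bmat2) ^ (2 : ℤ)).1
    rw [this]
    ext i j
    fin_cases i <;> fin_cases j <;>
      simp [cuM, Matrix.mul_apply, Fin.sum_univ_two] <;> ring

theorem AB_zpow_odd (k : ℤ) : ((Amat2 * Bmat2) ^ (2 * k + 1)).1 =
    !![-1 - (4 * (k : ℝ) + 2), - (4 * (k : ℝ) + 2); 4 * (k : ℝ) + 2, -1 + (4 * (k : ℝ) + 2)] := by
  rw [_root_.zpow_add_one, AB_zpow_even]
  change (cuM (4 * k)).1 * (Amat2 * Bmat2).1 = _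
  rw [AB_val]
  ext i j
  fin_cases i <;> fin_cases j <;>
    simp [cuM, Matrix.mul_apply, Fin.sum_univ_two] <;> ring

def Good (g : SL2R) : Prop :=
  ∃ h ∈ Subgroup.closure {Amat2, Bmat2}, ∃ k : ℤ,
          h * g * h⁻¹ = Amat2 ^ k ∨ h * g * h⁻¹ = Bmat2 ^ k ∨
          h * g * h⁻¹ = (Amat2 * Bmat2) ^ k

theorem Good.of_conj {u g : SL2R} (hu : u ∈ Subgroup.closure {Amat2, Bmat2})
    (h : Good (u * g * u⁻¹)) : Good g := by
  obtain ⟨h, hh, k, H⟩ := h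
  refine ⟨h * u, mul_mem hh hu, k, ?_⟩
  have : h * u * g * (h * u)⁻¹ = h * (u * g * u⁻¹) * h⁻¹ := by group
  rwa [this]

theorem upM_mem (k : ℤ) : upM (2 * k) ∈ Subgroup.closure {Amat2, Bmat2} := by
  have : upM (2 * k) = Amat2 ^ (-k) := by rw [Amat2_zpow]; push_cast; ring_nf
  rw [this]
  exact zpow_mem (Subgroup.subset_closure (by simp)) _

theorem loM_mem (k : ℤ) : loM (2 * k) ∈ Subgroup.closure {Amat2, Bmat2} := by
  rw [← Bmat2_zpow]
  exact zpow_mem (Subgroup.subset_closure (by simp)) _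

def parM (e x b c : ℤ) : Matrix (Fin 2) (Fin 2) ℝ :=
  !![(e : ℝ) + x, (b : ℝ); (c : ℝ), (e : ℝ) - x]

theorem up_conj {g : SL2R} {e x b c : ℤ} (hg : g.1 = parM e x b c) (k : ℤ) :
    (upM (2 * k) * g * (upM (2 * k))⁻¹).1 =
      parM e (x + 2 * k * c) (b - 4 * k * x - 4 * k * k * c) c := by
  change (upM (2 * k)).1 * g.1 * ((upM (2 * k))⁻¹).1 = _
  rw [hg, Matrix.SpecialLinearGroup.coe_inv, Matrix.adjugate_fin_two]
  ext i j
  fin_cases i <;> fin_cases j <;>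
    simp [parM, upM, Matrix.mul_apply, Fin.sum_univ_two] <;> ring

theorem lo_conj {g : SL2R} {e x b c : ℤ} (hg : g.1 = parM e x b c) (k : ℤ) :
    (loM (2 * k) * g * (loM (2 * k))⁻¹).1 =
      parM e (x - 2 * k * b) b (c + 4 * k * x - 4 * k * k * b) := by
  change (loM (2 * k)).1 * g.1 * ((loM (2 * k))⁻¹).1 = _
  rw [hg, Matrix.SpecialLinearGroup.coe_inv, Matrix.adjugate_fin_two]
  ext i j
  fin_cases i <;> fin_cases j <;>
    simp [parM, loM, Matrix.mul_apply, Fin.sum_univ_two] <;> ring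

theorem good_base {g : SL2R} {e x : ℤ} (hg : g.1 = parM e x x (-x))
    (he : (e = 1 ∧ x % 4 = 0) ∨ (e = -1 ∧ x % 4 = 2)) : Good g := by
  rcases he with ⟨rfl, hx⟩ | ⟨rfl, hx⟩
  · obtain ⟨k, rfl⟩ : ∃ k, x = 4 * k := ⟨x / 4, by omega⟩
    refine ⟨1, one_mem _, 2 * k, Or.inr (Or.inr ?_)⟩
    rw [AB_zpow_even]
    apply Subtype.ext
    simp [hg, parM, cuM]
  · obtain ⟨k, rfl⟩ : ∃ k, x = - (4 * k + 2) := ⟨(-x) / 4, by omega⟩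
    refine ⟨1, one_mem _, 2 * k + 1, Or.inr (Or.inr ?_)⟩
    apply Subtype.ext
    rw [AB_zpow_odd]
    simp [hg, parM]
    constructor <;> ring

theorem step_lt {x c : ℤ} (hc : c ≠ 0) (h : |c| < |x|) :
    ∃ k : ℤ, (x + 2 * k * c).natAbs < x.natAbs := by
  have h' : c.natAbs < x.natAbs := by rw [Int.abs_eq_natAbs, Int.abs_eq_natAbs] at h; omega
  rcases lt_or_gt_of_ne hc with h1 | h1 <;> rcases le_total 0 x with h2 | h2
  · exact ⟨1, by omega⟩
  · exact ⟨-1, by omega⟩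
  · exact ⟨-1, by omega⟩
  · exact ⟨1, by omega⟩

theorem good_par (n : ℕ) : ∀ (g : SL2R) (e x b c : ℤ), x.natAbs = n → g.1 = parM e x b c →
    x * x = - (b * c) → b % 2 = 0 → c % 2 = 0 →
    ((e = 1 ∧ x % 4 = 0) ∨ (e = -1 ∧ x % 4 = 2)) → Good g := by
  induction n using Nat.strong_induction_on with
  | _ n ih =>
  intro g e x b c hn hg hx hb hc he
  by_cases hx0 : x = 0
  · subst hx0
    have he1 : e = 1 := by omega
    subst he1
    have : b = 0 ∨ c = 0 := by
      rw [← mul_eq_zero]; linarith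
    rcases this with rfl | rfl
    · obtain ⟨k, rfl⟩ : ∃ k, c = 2 * k := ⟨c / 2, by omega⟩
      refine ⟨1, one_mem _, k, Or.inr (Or.inl ?_)⟩
      rw [Bmat2_zpow]
      apply Subtype.ext
      simp [hg, parM, loM]
    · obtain ⟨k, rfl⟩ : ∃ k, b = -2 * k := ⟨-b / 2, by omega⟩
      refine ⟨1, one_mem _, k, Or.inl ?_⟩
      rw [Amat2_zpow]
      apply Subtype.ext
      simp [hg, parM, upM]
  have hbc : |x| * |x| = |b| * |c| := by rw [← abs_mul, ← abs_mul, hx, abs_neg]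
  have hxp : 0 < |x| := abs_pos.2 hx0
  have hc0 : c ≠ 0 := by rintro rfl; simp at hx; exact hx0 hx
  have hb0 : b ≠ 0 := by rintro rfl; simp at hx; exact hx0 hx
  have hcp : 0 < |c| := abs_pos.2 hc0
  have hbp : 0 < |b| := abs_pos.2 hb0
  rcases lt_trichotomy (|c|) (|x|) with h | h | h
  · obtain ⟨k, hk⟩ := step_lt hc0 h
    apply Good.of_conj (upM_mem k)
    refine ih _ (hn ▸ hk) _ e _ _ _ rfl (up_conj hg k) ?_ ?_ hc ?_
    · linear_combination hx
    · have : b - 4 * k * x - 4 * k * k * c = b - 2 * (2 * k * x + 2 * k * k * c) := by ring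
      omega
    · obtain ⟨m, rfl⟩ : ∃ m, c = 2 * m := ⟨c / 2, by omega⟩
      have : x + 2 * k * (2 * m) = x + 4 * (k * m) := by ring
      omega
  · have h' : c = x ∨ c = -x := abs_eq_abs.1 h
    rcases h' with rfl | rfl
    · have : b = -c := by
        apply mul_right_cancel₀ hc0; linarith
      subst this
      apply Good.of_conj (upM_mem (-1))
      apply good_base (e := e) (x := -c)
      · rw [up_conj hg (-1)]; congr 1 <;> ring
      · omega
    · have : b = x := by
        apply mul_right_cancel₀ hx0; linarith
      subst this
      exact good_base hg he
  · have hbx : |b| < |x| := by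
      by_contra hcon
      push Not at hcon
      nlinarith
    obtain ⟨k, hk⟩ := step_lt hb0 hbx
    apply Good.of_conj (loM_mem (-k))
    refine ih (x + 2 * k * b).natAbs (hn ▸ hk) _ e _ _ _ ?_ (lo_conj hg (-k)) ?_ hb ?_ ?_
    · congr 1; ring
    · linear_combination hx
    · have : c + 4 * (-k) * x - 4 * (-k) * (-k) * b = c - 2 * (2 * k * x + 2 * k * k * b) := by ring
      omega
    · obtain ⟨m, rfl⟩ : ∃ m, b = 2 * m := ⟨b / 2, by omega⟩
      have : x - 2 * (-k) * (2 * m) = x + 4 * (k * m) := by ring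
      omega

theorem mem_form (g : SL2R) (hg : g ∈ Subgroup.closure {Amat2, Bmat2}) :
    ∃ a b c d : ℤ, g.1 = !![(1 + 4 * a : ℝ), 2 * (b : ℝ); 2 * (c : ℝ), 1 + 4 * (d : ℝ)] := by
  induction hg using Subgroup.closure_induction with
  | mem x hx =>
    rcases hx with rfl | rfl
    · exact ⟨0, -1, 0, 0, by simp [Amat2]⟩
    · exact ⟨0, 0, 1, 0, by simp [Bmat2]⟩
  | one => exact ⟨0, 0, 0, 0, by
      ext i j; fin_cases i <;> fin_cases j <;> simp⟩
  | mul x y _ _ hx hy =>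
    obtain ⟨a, b, c, d, h⟩ := hx
    obtain ⟨a', b', c', d', h'⟩ := hy
    refine ⟨a + a' + 4 * a * a' + b * c', b' + 4 * a * b' + b + 4 * b * d',
      c + 4 * c * a' + c' + 4 * d * c', d + d' + 4 * d * d' + c * b', ?_⟩
    change x.1 * y.1 = _
    rw [h, h']
    ext i j
    fin_cases i <;> fin_cases j <;>
      simp [Matrix.mul_apply, Fin.sum_univ_two] <;> ring
  | inv x _ hx =>
    obtain ⟨a, b, c, d, h⟩ := hx
    refine ⟨d, -b, -c, a, ?_⟩
    rw [Matrix.SpecialLinearGroup.coe_inv, h, Matrix.adjugate_fin_two]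
    simp

theorem trace_conj' (h g : SL2R) : Matrix.trace (h * g * h⁻¹).1 = Matrix.trace g.1 := by
  change Matrix.trace (h.1 * g.1 * (h⁻¹).1) = _
  rw [Matrix.trace_mul_comm, ← Matrix.mul_assoc]
  change Matrix.trace ((h⁻¹ * h).1 * g.1) = _
  rw [inv_mul_cancel]
  simp

theorem classification_mu_eq_four
    (g : SL2R) (hg : g ∈ Subgroup.closure {Amat2, Bmat2}) :
    2 < |Matrix.trace g.1| ↔
      ¬ ∃ h ∈ Subgroup.closure {Amat2, Bmat2}, ∃ k : ℤ,
          h * g * h⁻¹ = Amat2 ^ k ∨ h * g * h⁻¹ = Bmat2 ^ k ∨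
          h * g * h⁻¹ = (Amat2 * Bmat2) ^ k := by
  constructor
  · rintro ht ⟨h, -, k, H⟩
    rw [← trace_conj' h g] at ht
    apply absurd ht
    rw [not_lt]
    rcases H with H | H | H
    · rw [H, Amat2_zpow]; simp [upM, Matrix.trace_fin_two]; norm_num
    · rw [H, Bmat2_zpow]; simp [loM, Matrix.trace_fin_two]; norm_num
    · rw [H]
      rcases Int.even_or_odd' k with ⟨m, rfl | rfl⟩
      · rw [AB_zpow_even]; simp [cuM, Matrix.trace_fin_two]; norm_num
      · rw [AB_zpow_odd, Matrix.trace_fin_two_of, abs_le]; constructor <;> linarith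
  · intro hn
    by_contra ht
    apply hn
    change Good g
    rw [not_lt] at ht
    obtain ⟨a, b, c, d, h⟩ := mem_form g hg
    have hdet := g.2
    rw [h, Matrix.det_fin_two_of] at hdet
    rw [h, Matrix.trace_fin_two_of, abs_le] at ht
    have hdet' : (1 + 4 * a) * (1 + 4 * d) - 2 * b * (2 * c) = 1 := by exact_mod_cast hdet
    have h1 : -2 ≤ 1 + 4 * a + (1 + 4 * d) := by exact_mod_cast ht.1
    have h2 : 1 + 4 * a + (1 + 4 * d) ≤ 2 := by exact_mod_cast ht.2
    have h3 : d = -a ∨ d = -1 - a := by omega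
    rcases h3 with rfl | rfl
    · refine good_par _ g 1 (4 * a) (2 * b) (2 * c) rfl ?_ ?_ (by omega) (by omega) (by omega)
      · rw [h, parM]; push_cast; ring_nf
      · linarith
    · refine good_par _ g (-1) (2 + 4 * a) (2 * b) (2 * c) rfl ?_ ?_ (by omega) (by omega)
        (by omega)
      · rw [h, parM]; push_cast; ring_nf
      · linarith
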